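/- arXiv:1110.2585 — 5 statements merged into one kernel-verified Lean document; each statement's English description precedes it below -/
import Mathlib

section
/- Let α ∈ (0,1) and let F̄ : ℝ → ℝ be a nonincreasing function with 0 ≤ F̄ ≤ 1 which is regularly varying at +∞ with index −α, i.e. F̄(t) > 0 for all sufficiently large t and for every λ > 0, F̄(λt)/F̄(t) → λ^{−α} as t → +∞. Let (a_n)_{n≥1} be a sequence of positive reals with a_n/n → ∞ and n·F̄(a_n) → 1 as n → ∞. Then for every t > 0, lim_{n→∞} Σ_{k=1}^n F̄(k·t·a_n/n) = t^{−α}/(1−α). -/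
open Filter Topology

/-- A monotone regularly varying function satisfies `F (r t) / F t → u ^ (-α)` whenever `r → u > 0`
and `t → ∞`. -/
lemma tendsto_div_of_antitone_of_regularlyVarying {ι : Type*} {l : Filter ι} {α : ℝ} {F : ℝ → ℝ}
    (hmono : Antitone F) (hF0 : ∀ t, 0 ≤ F t)
    (hreg : ∀ lam : ℝ, 0 < lam →
      Tendsto (fun t => F (lam * t) / F t) atTop (𝓝 (lam ^ (-α))))
    {r T : ι → ℝ} {u : ℝ} (hu : 0 < u) (hr : Tendsto r l (𝓝 u)) (hT : Tendsto T l atTop) :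
    Tendsto (fun i => F (r i * T i) / F (T i)) l (𝓝 (u ^ (-α))) := by
  have hcont : ContinuousAt (fun v : ℝ => v ^ (-α)) u :=
    Real.continuousAt_rpow_const _ _ (Or.inl hu.ne')
  refine tendsto_order.2 ⟨fun b hb => ?_, fun b hb => ?_⟩
  · obtain ⟨v, hvb, hv⟩ := (((hcont.eventually (lt_mem_nhds hb)).filter_mono
      (nhdsWithin_le_nhds (s := Set.Ioi u))).and self_mem_nhdsWithin).exists
    have hv : u < v := hv
    filter_upwards [((hreg v (hu.trans hv)).comp hT).eventually (lt_mem_nhds hvb),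
      hr.eventually (gt_mem_nhds hv), hT.eventually_ge_atTop 0] with i h1 h2 h3
    exact h1.trans_le (div_le_div_of_nonneg_right
      (hmono (mul_le_mul_of_nonneg_right h2.le h3)) (hF0 _))
  · obtain ⟨v, ⟨hvb, hv0⟩, hv⟩ := ((((hcont.eventually (gt_mem_nhds hb)).and
      (lt_mem_nhds hu)).filter_mono (nhdsWithin_le_nhds (s := Set.Iio u))).and
      self_mem_nhdsWithin).exists
    have hv : v < u := hv
    filter_upwards [((hreg v hv0).comp hT).eventually (gt_mem_nhds hvb),
      hr.eventually (lt_mem_nhds hv), hT.eventually_ge_atTop 0] with i h1 h2 h3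
    exact (div_le_div_of_nonneg_right
      (hmono (mul_le_mul_of_nonneg_right h2.le h3)) (hF0 _)).trans_lt h1

/-- Potter's bound for a monotone regularly varying function. -/
lemma exists_potter_bound {α β : ℝ} (hβ : 0 ≤ β) (hαβ : α < β) {F : ℝ → ℝ}
    (hmono : Antitone F) (hF0 : ∀ t, 0 ≤ F t) (hFpos : ∃ t₀ : ℝ, ∀ t ≥ t₀, 0 < F t)
    (hreg : Tendsto (fun t => F (2 * t) / F t) atTop (𝓝 (2 ^ (-α)))) :
    ∃ s₀ > 0, ∀ s T, s₀ ≤ s → s ≤ T → F s ≤ 2 ^ β * (T / s) ^ β * F T := by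
  obtain ⟨t₀, ht₀⟩ := hFpos
  have hlt : (2 : ℝ) ^ (-β) < 2 ^ (-α) := Real.rpow_lt_rpow_of_exponent_lt one_lt_two (by linarith)
  obtain ⟨s₁, hs₁⟩ := eventually_atTop.1 (hreg.eventually (lt_mem_nhds hlt))
  have hdouble : ∀ s, max 1 (max t₀ s₁) ≤ s → F s ≤ 2 ^ β * F (2 * s) := by
    intro s hs
    have hFs := ht₀ s (by simp at hs; tauto)
    have h := hs₁ s (by simp at hs; tauto)
    rw [lt_div_iff₀ hFs, Real.rpow_neg zero_le_two, inv_mul_lt_iff₀ (by positivity)] at h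
    exact h.le
  have hpow : ∀ (n : ℕ) (s : ℝ), max 1 (max t₀ s₁) ≤ s → F s ≤ (2 ^ β) ^ n * F (2 ^ n * s) := by
    intro n
    induction n with
    | zero => intro s _; simp
    | succ n ih =>
      intro s hs
      have hs1 : 1 ≤ s := (le_max_left _ _).trans hs
      calc F s ≤ 2 ^ β * F (2 * s) := hdouble s hs
        _ ≤ 2 ^ β * ((2 ^ β) ^ n * F (2 ^ n * (2 * s))) := by
          gcongr
          exact ih _ (by linarith)
        _ = (2 ^ β) ^ (n + 1) * F (2 ^ (n + 1) * s) := by ring_nf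
  refine ⟨max 1 (max t₀ s₁), by positivity, fun s T hs hsT => ?_⟩
  have hs0 : 0 < s := zero_lt_one.trans_le ((le_max_left _ _).trans hs)
  obtain ⟨n, hn1, hn2⟩ := exists_nat_pow_near ((one_le_div hs0).2 hsT) (one_lt_two (α := ℝ))
  calc F s ≤ (2 ^ β) ^ (n + 1) * F (2 ^ (n + 1) * s) := hpow _ s hs
    _ ≤ (2 ^ β) ^ (n + 1) * F T := by
      gcongr
      exact hmono ((div_lt_iff₀ hs0).1 hn2).le
    _ = 2 ^ β * (2 ^ n : ℝ) ^ β * F T := by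
      rw [← Real.rpow_natCast 2 n, ← Real.rpow_mul zero_le_two, mul_comm (n : ℝ) β,
        Real.rpow_mul zero_le_two, Real.rpow_natCast, pow_succ']
    _ ≤ 2 ^ β * (T / s) ^ β * F T := by
      have := hF0 T
      gcongr

lemma integral_comp_natCeil (g : ℕ → ℝ) (n : ℕ) :
    ∫ v in (0 : ℝ)..n, g ⌈v⌉₊ = ∑ k ∈ Finset.Icc 1 n, g k := by
  have heq : ∀ k : ℕ, Set.EqOn (fun _ : ℝ => g (k + 1)) (fun v : ℝ => g ⌈v⌉₊)
      (Set.uIoc (k : ℝ) ((k + 1 : ℕ) : ℝ)) := by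
    intro k v hv
    rw [Set.uIoc_of_le (by simp)] at hv
    have : ⌈v⌉₊ = k + 1 := (Nat.ceil_eq_iff k.succ_ne_zero).2 (by simpa using hv)
    simp only [this]
  have hsum := intervalIntegral.sum_integral_adjacent_intervals (a := fun k : ℕ => (k : ℝ))
    (f := fun v : ℝ => g ⌈v⌉₊) (μ := MeasureTheory.volume) (n := n)
    fun k _ => intervalIntegrable_const.congr (heq k)
  rw [Nat.cast_zero] at hsum
  rw [← hsum, Finset.range_eq_Ico, ← Finset.Ico_add_one_right_eq_Icc,
    ← Finset.sum_Ico_add' g 0 n 1]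
  refine Finset.sum_congr rfl fun k _ => ?_
  rw [← intervalIntegral.integral_congr_ae (Eventually.of_forall (heq k))]
  simp

lemma integral_comp_natCeil_mul (g : ℕ → ℝ) {n : ℕ} (hn : n ≠ 0) :
    ∫ u in (0 : ℝ)..1, n * g ⌈(n : ℝ) * u⌉₊ = ∑ k ∈ Finset.Icc 1 n, g k := by
  have hn' : (n : ℝ) ≠ 0 := Nat.cast_ne_zero.2 hn
  rw [intervalIntegral.integral_const_mul,
    intervalIntegral.integral_comp_mul_left (fun v : ℝ => g ⌈v⌉₊) hn', mul_zero, mul_one,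
    integral_comp_natCeil, smul_eq_mul, mul_inv_cancel_left₀ hn']

/-- if `F̄` is a nonincreasing function with values in `[0,1]`, regularly
varying at `+∞` with index `-α` for some `α ∈ (0,1)`, and `a_n` satisfies `a_n/n → ∞`
and `n·F̄(a_n) → 1`, then for every `t > 0`,
`Σ_{k=1}^n F̄(k t a_n / n) → t^{-α}/(1-α)`. -/
theorem sum_tail_tendsto (α : ℝ) (hα0 : 0 < α) (hα1 : α < 1) (F : ℝ → ℝ)
    (hmono : Antitone F) (hF0 : ∀ t, 0 ≤ F t) (hF1 : ∀ t, F t ≤ 1)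
    (hFpos : ∃ t₀ : ℝ, ∀ t ≥ t₀, 0 < F t)
    (hreg : ∀ lam : ℝ, 0 < lam →
      Tendsto (fun t => F (lam * t) / F t) atTop (𝓝 (lam ^ (-α))))
    (a : ℕ → ℝ) (hapos : ∀ n, 0 < a n)
    (ha1 : Tendsto (fun n : ℕ => a n / n) atTop atTop)
    (ha2 : Tendsto (fun n : ℕ => (n : ℝ) * F (a n)) atTop (𝓝 1)) :
    ∀ t : ℝ, 0 < t →
      Tendsto (fun n : ℕ => ∑ k ∈ Finset.Icc 1 n, F ((k : ℝ) * t * a n / n)) atTop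
        (𝓝 (t ^ (-α) / (1 - α))) := by
  intro t ht
  have hat : Tendsto a atTop atTop := by
    refine tendsto_atTop_mono' _ ?_ ha1
    filter_upwards [eventually_ge_atTop 1] with n hn
    exact div_le_self (hapos n).le (by exact_mod_cast hn)
  have hT : Tendsto (fun n => t * a n) atTop atTop := hat.const_mul_atTop ht
  have hx : Tendsto (fun n : ℕ => t * a n / n) atTop atTop := by
    simpa only [mul_div_assoc] using ha1.const_mul_atTop ht
  have hFapos : ∀ᶠ s in atTop, 0 < F s := eventually_atTop.2 hFpos
  have hnF : Tendsto (fun n : ℕ => n * F (t * a n)) atTop (𝓝 (t ^ (-α))) := by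
    have h := ha2.mul ((hreg t ht).comp hat)
    rw [one_mul] at h
    refine h.congr' ?_
    filter_upwards [hat.eventually hFapos] with n hn
    simp only [Function.comp_apply]
    field_simp
  obtain ⟨β, hαβ, hβ1⟩ := exists_between hα1
  have hβ0 : 0 < β := hα0.trans hαβ
  obtain ⟨s₀, hs₀, hpotter⟩ :=
    exists_potter_bound hβ0.le hαβ hmono hF0 hFpos (hreg 2 zero_lt_two)
  have hlim : Tendsto
      (fun n : ℕ => ∫ u in (0 : ℝ)..1, n * F ((⌈(n : ℝ) * u⌉₊ : ℝ) * t * a n / n)) atTop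
      (𝓝 (∫ u in (0 : ℝ)..1, t ^ (-α) * u ^ (-α))) := by
    refine intervalIntegral.tendsto_integral_filter_of_dominated_convergence
      (fun u => 2 ^ β * (t ^ (-α) + 1) * u ^ (-β)) ?_ ?_ ?_ ?_
    · refine Eventually.of_forall fun n => Measurable.aestronglyMeasurable ?_
      exact (measurable_from_top (f := fun k : ℕ => (n : ℝ) * F ((k : ℝ) * t * a n / n))).comp
        (Nat.measurable_ceil.comp (measurable_const_mul (n : ℝ)))
    · filter_upwards [hnF.eventually (gt_mem_nhds (lt_add_one _)), hx.eventually_ge_atTop s₀,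
        eventually_gt_atTop 0] with n hM hxn hn
      refine Eventually.of_forall fun u hu => ?_
      rw [Set.uIoc_of_le zero_le_one] at hu
      obtain ⟨hu0, hu1⟩ := hu
      have hn' : (0 : ℝ) < n := Nat.cast_pos.2 hn
      have hk : (n : ℝ) * u ≤ ⌈(n : ℝ) * u⌉₊ := Nat.le_ceil _
      have hk1 : (1 : ℝ) ≤ ⌈(n : ℝ) * u⌉₊ := by
        exact_mod_cast Nat.ceil_pos.2 (mul_pos hn' hu0)
      have hkn : (⌈(n : ℝ) * u⌉₊ : ℝ) ≤ n := by
        exact_mod_cast Nat.ceil_le.2 (mul_le_of_le_one_right hn'.le hu1)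
      generalize (⌈(n : ℝ) * u⌉₊ : ℝ) = k at hk hk1 hkn
      have hTn : 0 < t * a n := mul_pos ht (hapos n)
      have hs : k * t * a n / n = k * (t * a n / n) := by ring
      have hbound := hpotter (k * t * a n / n) (t * a n)
        (by rw [hs]; nlinarith)
        (by rw [div_le_iff₀ hn']; nlinarith)
      have hratio : t * a n / (k * t * a n / n) ≤ u⁻¹ := by
        have : t * a n / (k * t * a n / n) = n / k := by
          have := (hapos n).ne'
          field_simp
        rw [this, div_le_iff₀ (by linarith), inv_mul_eq_div, le_div_iff₀ hu0]
        exact hk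
      rw [Real.norm_of_nonneg (mul_nonneg hn'.le (hF0 _))]
      have han := hapos n
      have hFT := hF0 (t * a n)
      calc (n : ℝ) * F (k * t * a n / n)
          ≤ n * (2 ^ β * (t * a n / (k * t * a n / n)) ^ β * F (t * a n)) := by gcongr
        _ ≤ n * (2 ^ β * u⁻¹ ^ β * F (t * a n)) := by gcongr
        _ = 2 ^ β * (n * F (t * a n)) * u ^ (-β) := by
          rw [Real.inv_rpow hu0.le, Real.rpow_neg hu0.le]
          ring
        _ ≤ 2 ^ β * (t ^ (-α) + 1) * u ^ (-β) := by gcongr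
    · exact (intervalIntegral.intervalIntegrable_rpow' (by linarith)).const_mul _
    · refine Eventually.of_forall fun u hu => ?_
      rw [Set.uIoc_of_le zero_le_one] at hu
      have hr : Tendsto (fun n : ℕ => (⌈(n : ℝ) * u⌉₊ : ℝ) / n) atTop (𝓝 u) := by
        simpa only [mul_comm u, Function.comp_def] using
          (tendsto_nat_ceil_mul_div_atTop hu.1.le).comp tendsto_natCast_atTop_atTop
      refine (hnF.mul (tendsto_div_of_antitone_of_regularlyVarying hmono hF0 hreg hu.1 hr hT)).congr'
        ?_
      filter_upwards [hT.eventually hFapos] with n hn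
      rw [mul_assoc, mul_div_cancel₀ _ hn.ne']
      congr 2
      ring
  rw [intervalIntegral.integral_const_mul, integral_rpow (Or.inl (by linarith)), Real.one_rpow,
    Real.zero_rpow (by linarith), sub_zero, neg_add_eq_sub, mul_one_div] at hlim
  refine hlim.congr' ?_
  filter_upwards [eventually_ne_atTop 0] with n hn
  exact integral_comp_natCeil_mul (fun k => F ((k : ℝ) * t * a n / n)) hn
end

section
/- Let c > 1 and let β ∈ ℝ with β ≠ −1, β ≠ −3/2 and β ≠ −2. Then the integral of the function (x₁, x₂) ↦ (c−x₁)^β·(c−x₂)^β·(x₂−x₁) over the triangle {(x₁, x₂) ∈ ℝ² : 0 < x₁ < x₂ < 1} (with respect to two-dimensional Lebesgue measure) equals (c^{2β+3} − (c−1)^{2β+3} − (2β+3)·c^{β+1}·(c−1)^{β+1}) / ((β+1)·(β+2)·(2β+3)). -/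
open MeasureTheory

/-- Fubini for a function continuous on the closed unit square, over the triangle
`0 < x < y < 1`. -/
theorem setIntegral_triangle_eq_intervalIntegral {f : ℝ × ℝ → ℝ}
    (hf : ContinuousOn f (Set.Icc 0 1 ×ˢ Set.Icc 0 1)) :
    ∫ p in {p : ℝ × ℝ | 0 < p.1 ∧ p.1 < p.2 ∧ p.2 < 1}, f p =
      ∫ x in (0 : ℝ)..1, ∫ y in x..1, f (x, y) := by
  have hmeas : MeasurableSet {p : ℝ × ℝ | 0 < p.1 ∧ p.1 < p.2 ∧ p.2 < 1} :=
    (measurableSet_lt measurable_const measurable_fst).inter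
      ((measurableSet_lt measurable_fst measurable_snd).inter
        (measurableSet_lt measurable_snd measurable_const))
  have hint : IntegrableOn f {p : ℝ × ℝ | 0 < p.1 ∧ p.1 < p.2 ∧ p.2 < 1} := by
    refine (hf.integrableOn_compact (isCompact_Icc.prod isCompact_Icc)).mono_set ?_
    rintro ⟨x, y⟩ ⟨h0, hxy, h1⟩
    exact ⟨⟨h0.le, (hxy.trans h1).le⟩, ⟨(h0.trans hxy).le, h1.le⟩⟩
  rw [← integral_indicator hmeas, Measure.volume_eq_prod,
    integral_prod _ ((integrable_indicator_iff hmeas).2 hint),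
    intervalIntegral.integral_of_le zero_le_one, integral_Ioc_eq_integral_Ioo,
    ← integral_indicator measurableSet_Ioo]
  congr 1
  ext x
  by_cases hx : x ∈ Set.Ioo (0 : ℝ) 1
  · rw [Set.indicator_of_mem hx, intervalIntegral.integral_of_le hx.2.le,
      integral_Ioc_eq_integral_Ioo, ← integral_indicator measurableSet_Ioo]
    congr 1
    ext y
    simp [Set.indicator_apply, hx.1]
  · rw [Set.indicator_of_notMem hx]
    refine (integral_congr_ae (Filter.Eventually.of_forall fun y => ?_)).trans
      (integral_zero ℝ ℝ)
    refine Set.indicator_of_notMem ?_ _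
    rintro ⟨h0, hxy, h1⟩
    exact hx ⟨h0, hxy.trans h1⟩

theorem hasDerivAt_const_sub_rpow {c y : ℝ} (h : y < c) (a : ℝ) :
    HasDerivAt (fun t => (c - t) ^ a) (-(a * (c - y) ^ (a - 1))) y := by
  refine (((hasDerivAt_id' y).const_sub c).rpow_const (p := a)
    (Or.inl (sub_pos.2 h).ne')).congr_deriv ?_
  ring

theorem continuousOn_const_sub_rpow {c : ℝ} (hc : 1 < c) (a x : ℝ) (hx : x ≤ 1) :
    ContinuousOn (fun t => (c - t) ^ a) (Set.uIcc x 1) := by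
  intro t ht
  rw [Set.uIcc_of_le hx] at ht
  exact (hasDerivAt_const_sub_rpow (ht.2.trans_lt hc) a).continuousAt.continuousWithinAt

theorem integral_rpow_mul_sub {c β x : ℝ} (hc : 1 < c) (hx : x ≤ 1)
    (hβ1 : β + 1 ≠ 0) (hβ2 : β + 2 ≠ 0) :
    ∫ y in x..1, (c - x) ^ β * (c - y) ^ β * (y - x) =
      (c - x) ^ (2 * β + 2) / ((β + 1) * (β + 2)) -
        (c - 1) ^ (β + 1) / (β + 1) * (c - x) ^ (β + 1) +
        (c - 1) ^ (β + 2) / (β + 2) * (c - x) ^ β := by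
  have hxc : 0 < c - x := by linarith
  rw [intervalIntegral.integral_eq_sub_of_hasDerivAt (f := fun y =>
    (c - x) ^ β * ((c - y) ^ (β + 2) / (β + 2) - (c - x) * ((c - y) ^ (β + 1) / (β + 1))))]
  · have e1 : (c - x) ^ (β + 1) = (c - x) ^ β * (c - x) := by
      rw [Real.rpow_add hxc, Real.rpow_one]
    have e2 : (c - x) ^ (β + 2) = (c - x) ^ β * (c - x) ^ 2 := by
      rw [Real.rpow_add hxc, Real.rpow_two]
    have e3 : (c - x) ^ (2 * β + 2) = (c - x) ^ β * (c - x) ^ β * (c - x) ^ 2 := by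
      rw [Real.rpow_add hxc, Real.rpow_two, two_mul, Real.rpow_add hxc]
    simp only [e1, e2, e3]
    field_simp
    ring
  · intro y hy
    rw [Set.uIcc_of_le hx] at hy
    have hyc : y < c := hy.2.trans_lt hc
    refine ((((hasDerivAt_const_sub_rpow hyc (β + 2)).div_const (β + 2)).sub
      (((hasDerivAt_const_sub_rpow hyc (β + 1)).div_const (β + 1)).const_mul
        (c - x))).const_mul ((c - x) ^ β)).congr_deriv ?_
    have e1 : (c - y) ^ (β + 2 - 1) = (c - y) ^ β * (c - y) := by
      rw [show β + 2 - 1 = β + 1 by ring, Real.rpow_add (sub_pos.2 hyc), Real.rpow_one]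
    rw [e1, add_sub_cancel_right]
    field_simp
    ring
  · exact ((continuousOn_const.mul (continuousOn_const_sub_rpow hc β x hx)).mul
      (by fun_prop)).intervalIntegrable

/-- for `c > 1` and `β ∉ {-1, -3/2, -2}`, the integral of
`(c-x₁)^β (c-x₂)^β (x₂-x₁)` over the triangle `0 < x₁ < x₂ < 1` equals
`(c^{2β+3} - (c-1)^{2β+3} - (2β+3) c^{β+1} (c-1)^{β+1}) / ((β+1)(β+2)(2β+3))`. -/
theorem integral_triangle_rpow (c β : ℝ) (hc : 1 < c)
    (hβ1 : β ≠ -1) (hβ2 : β ≠ -3/2) (hβ3 : β ≠ -2) :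
    ∫ p in {p : ℝ × ℝ | 0 < p.1 ∧ p.1 < p.2 ∧ p.2 < 1},
        (c - p.1) ^ β * (c - p.2) ^ β * (p.2 - p.1) ∂(volume : Measure (ℝ × ℝ)) =
      (c ^ (2 * β + 3) - (c - 1) ^ (2 * β + 3) -
          (2 * β + 3) * c ^ (β + 1) * (c - 1) ^ (β + 1)) /
        ((β + 1) * (β + 2) * (2 * β + 3)) := by
  have h1 : β + 1 ≠ 0 := fun h => hβ1 (by linarith)
  have h2 : β + 2 ≠ 0 := fun h => hβ3 (by linarith)
  have h3 : 2 * β + 3 ≠ 0 := fun h => hβ2 (by linarith)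
  have hc0 : 0 < c := by linarith
  have hd0 : 0 < c - 1 := by linarith
  rw [setIntegral_triangle_eq_intervalIntegral]
  · rw [intervalIntegral.integral_congr (g := fun x =>
      (c - x) ^ (2 * β + 2) / ((β + 1) * (β + 2)) -
        (c - 1) ^ (β + 1) / (β + 1) * (c - x) ^ (β + 1) +
        (c - 1) ^ (β + 2) / (β + 2) * (c - x) ^ β),
      intervalIntegral.integral_eq_sub_of_hasDerivAt (f := fun x =>
        -((c - x) ^ (2 * β + 3) / ((β + 1) * (β + 2) * (2 * β + 3))) +
          (c - 1) ^ (β + 1) / (β + 1) * ((c - x) ^ (β + 2) / (β + 2)) -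
          (c - 1) ^ (β + 2) / (β + 2) * ((c - x) ^ (β + 1) / (β + 1)))]
    · have e (t : ℝ) (ht : 0 < t) : t ^ (β + 2) = t ^ (β + 1) * t := by
        rw [show β + 2 = β + 1 + 1 by ring, Real.rpow_add ht (β + 1), Real.rpow_one]
      simp only [sub_zero, e c hc0, e (c - 1) hd0]
      field_simp
      ring
    · intro x hx
      rw [Set.uIcc_of_le zero_le_one] at hx
      have hxc : x < c := hx.2.trans_lt hc
      refine ((((hasDerivAt_const_sub_rpow hxc (2 * β + 3)).div_const
        ((β + 1) * (β + 2) * (2 * β + 3))).neg.add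
        (((hasDerivAt_const_sub_rpow hxc (β + 2)).div_const (β + 2)).const_mul
          ((c - 1) ^ (β + 1) / (β + 1)))).sub
        (((hasDerivAt_const_sub_rpow hxc (β + 1)).div_const (β + 1)).const_mul
          ((c - 1) ^ (β + 2) / (β + 2)))).congr_deriv ?_
      rw [show 2 * β + 3 - 1 = 2 * β + 2 by ring, show β + 2 - 1 = β + 1 by ring,
        add_sub_cancel_right]
      field_simp
      ring
    · have hcont (a : ℝ) := continuousOn_const_sub_rpow hc a 0 zero_le_one
      exact ((((hcont _).div_const _).sub (continuousOn_const.mul (hcont _))).add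
        (continuousOn_const.mul (hcont _))).intervalIntegrable
    · intro x hx
      rw [Set.uIcc_of_le zero_le_one] at hx
      exact integral_rpow_mul_sub hc hx.2 h1 h2
  · refine ((ContinuousOn.rpow_const (by fun_prop) ?_).mul
      (ContinuousOn.rpow_const (by fun_prop) ?_)).mul (by fun_prop)
    · exact fun p hp => Or.inl (sub_pos.2 (hp.1.2.trans_lt hc)).ne'
    · exact fun p hp => Or.inl (sub_pos.2 (hp.2.2.trans_lt hc)).ne'
end

section
/- Let c > 1. Then the integral of the function (x₁, x₂) ↦ (c−x₁)^{−3/2}·(c−x₂)^{−3/2}·(x₂−x₁) over the triangle {(x₁, x₂) ∈ ℝ² : 0 < x₁ < x₂ < 1} (with respect to two-dimensional Lebesgue measure) equals −4·log(c/(c−1)) + 4/√(c·(c−1)). -/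
open MeasureTheory

lemma rpow_neg_three_halves_eq {u : ℝ} (hu : 0 < u) :
    u ^ (-3/2 : ℝ) = (Real.sqrt u ^ 3)⁻¹ := by
  rw [show (-3/2 : ℝ) = -((1/2) * (3 : ℕ)) by norm_num, Real.rpow_neg hu.le,
    Real.rpow_mul_natCast hu.le, Real.sqrt_eq_rpow]

lemma hasDerivAt_sqrt_const_sub {c x : ℝ} (hx : x < c) :
    HasDerivAt (fun y => Real.sqrt (c - y)) (-1 / (2 * Real.sqrt (c - x))) x :=
  ((hasDerivAt_id x).const_sub c).sqrt (sub_pos.2 hx).ne'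

lemma integral_inner_rpow_neg_three_halves {c x : ℝ} (hc : 1 < c) (hx : x < 1) :
    ∫ y in x..1, (c - x) ^ (-3/2 : ℝ) * (c - y) ^ (-3/2 : ℝ) * (y - x) =
      2 / (Real.sqrt (c - 1) * Real.sqrt (c - x)) +
        2 * Real.sqrt (c - 1) / Real.sqrt (c - x) ^ 3 - 4 / (c - x) := by
  have hlt : ∀ y ∈ Set.uIcc x 1, y < c := fun y hy => by
    rw [Set.uIcc_of_le hx.le] at hy; linarith [hy.2]
  have hs : 0 < Real.sqrt (c - x) := Real.sqrt_pos.2 (by linarith)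
  have ha : 0 < Real.sqrt (c - 1) := Real.sqrt_pos.2 (by linarith)
  have hs2 : Real.sqrt (c - x) ^ 2 = c - x := Real.sq_sqrt (by linarith)
  rw [intervalIntegral.integral_eq_sub_of_hasDerivAt
    (f := fun y => (Real.sqrt (c - x) ^ 3)⁻¹ *
      (2 * (c - x) * (Real.sqrt (c - y))⁻¹ + 2 * Real.sqrt (c - y)))]
  · rw [← hs2, Real.sqrt_sq hs.le]
    field_simp
    ring
  · intro y hy
    have hyc := hlt y hy
    have ht : 0 < Real.sqrt (c - y) := Real.sqrt_pos.2 (by linarith)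
    have ht2 : Real.sqrt (c - y) ^ 2 = c - y := Real.sq_sqrt (by linarith)
    have hd := hasDerivAt_sqrt_const_sub hyc
    refine ((((hd.inv ht.ne').const_mul (2 * (c - x))).add (hd.const_mul 2)).const_mul
      (Real.sqrt (c - x) ^ 3)⁻¹).congr_deriv ?_
    rw [rpow_neg_three_halves_eq (by linarith : 0 < c - x),
      rpow_neg_three_halves_eq (by linarith : 0 < c - y),
      show y - x = (c - x) - Real.sqrt (c - y) ^ 2 by rw [ht2]; ring]
    field_simp
    ring
  · refine ContinuousOn.intervalIntegrable fun y hy => ContinuousAt.continuousWithinAt ?_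
    have hyc : c - y ≠ 0 := (sub_pos.2 (hlt y hy)).ne'
    exact (continuousAt_const.mul ((continuousAt_const.sub continuousAt_id).rpow_const
      (Or.inl hyc))).mul (continuousAt_id.sub continuousAt_const)

lemma integral_outer_rpow_neg_three_halves {c : ℝ} (hc : 1 < c) :
    ∫ x in (0 : ℝ)..1, (2 / (Real.sqrt (c - 1) * Real.sqrt (c - x)) +
        2 * Real.sqrt (c - 1) / Real.sqrt (c - x) ^ 3 - 4 / (c - x)) =
      -4 * Real.log (c / (c - 1)) + 4 / Real.sqrt (c * (c - 1)) := by
  have hlt : ∀ y ∈ Set.uIcc (0 : ℝ) 1, y < c := fun y hy => by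
    rw [Set.uIcc_of_le zero_le_one] at hy; linarith [hy.2]
  have hs : 0 < Real.sqrt c := Real.sqrt_pos.2 (by linarith)
  have ha : 0 < Real.sqrt (c - 1) := Real.sqrt_pos.2 (by linarith)
  have hs2 : Real.sqrt c ^ 2 = c := Real.sq_sqrt (by linarith)
  have ha2 : Real.sqrt (c - 1) ^ 2 = c - 1 := Real.sq_sqrt (by linarith)
  rw [intervalIntegral.integral_eq_sub_of_hasDerivAt
    (f := fun x => -4 / Real.sqrt (c - 1) * Real.sqrt (c - x) +
      4 * Real.sqrt (c - 1) * (Real.sqrt (c - x))⁻¹ + 4 * Real.log (c - x))]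
  · rw [sub_zero, Real.log_div (by linarith) (by linarith), Real.sqrt_mul (by linarith)]
    field_simp
    rw [hs2, ha2]
    ring
  · intro y hy
    have hyc := hlt y hy
    have ht : 0 < Real.sqrt (c - y) := Real.sqrt_pos.2 (by linarith)
    have ht2 : Real.sqrt (c - y) ^ 2 = c - y := Real.sq_sqrt (by linarith)
    have hd := hasDerivAt_sqrt_const_sub hyc
    have hl := ((hasDerivAt_id y).const_sub c).log (sub_pos.2 hyc).ne'
    refine (((hd.const_mul (-4 / Real.sqrt (c - 1))).add
      ((hd.inv ht.ne').const_mul (4 * Real.sqrt (c - 1)))).add (hl.const_mul 4)).congr_deriv ?_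
    simp only [id]
    rw [← ht2, Real.sqrt_sq ht.le]
    field_simp
    ring
  · refine ContinuousOn.intervalIntegrable fun y hy => ContinuousAt.continuousWithinAt ?_
    have hyc : 0 < c - y := sub_pos.2 (hlt y hy)
    have ht : 0 < Real.sqrt (c - y) := Real.sqrt_pos.2 hyc
    have hd := (hasDerivAt_sqrt_const_sub (hlt y hy)).continuousAt
    exact ((continuousAt_const.div (continuousAt_const.mul hd) (mul_pos ha ht).ne').add
      (continuousAt_const.div (hd.pow 3) (pow_pos ht 3).ne')).sub
      (continuousAt_const.div (continuousAt_const.sub continuousAt_id) hyc.ne')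

lemma integrableOn_triangle_rpow_neg_three_halves {c : ℝ} (hc : 1 < c) :
    IntegrableOn (fun p : ℝ × ℝ => (c - p.1) ^ (-3/2 : ℝ) * (c - p.2) ^ (-3/2 : ℝ) * (p.2 - p.1))
      {p : ℝ × ℝ | 0 < p.1 ∧ p.1 < p.2 ∧ p.2 < 1} := by
  refine IntegrableOn.mono_set (t := Set.Icc 0 1 ×ˢ Set.Icc 0 1) ?_ ?_
  · refine ContinuousOn.integrableOn_compact (isCompact_Icc.prod isCompact_Icc)
      fun p hp => ContinuousAt.continuousWithinAt ?_
    have h1 : c - p.1 ≠ 0 := by linarith [hp.1.2]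
    have h2 : c - p.2 ≠ 0 := by linarith [hp.2.2]
    exact (((continuousAt_const.sub continuousAt_fst).rpow_const (Or.inl h1)).mul
      ((continuousAt_const.sub continuousAt_snd).rpow_const (Or.inl h2))).mul
      (continuousAt_snd.sub continuousAt_fst)
  · rintro p ⟨h0, h1, h2⟩
    exact ⟨⟨h0.le, (h1.trans h2).le⟩, ⟨(h0.trans h1).le, h2.le⟩⟩

lemma setIntegral_triangle_eq {f : ℝ × ℝ → ℝ}
    (hf : IntegrableOn f {p : ℝ × ℝ | 0 < p.1 ∧ p.1 < p.2 ∧ p.2 < 1}) :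
    ∫ p in {p : ℝ × ℝ | 0 < p.1 ∧ p.1 < p.2 ∧ p.2 < 1}, f p =
      ∫ x in Set.Ioo (0 : ℝ) 1, ∫ y in Set.Ioo x 1, f (x, y) := by
  have hT : MeasurableSet {p : ℝ × ℝ | 0 < p.1 ∧ p.1 < p.2 ∧ p.2 < 1} :=
    (measurableSet_lt measurable_const measurable_fst).inter
      ((measurableSet_lt measurable_fst measurable_snd).inter
        (measurableSet_lt measurable_snd measurable_const))
  rw [← integral_indicator hT, Measure.volume_eq_prod, integral_prod _
    ((integrable_indicator_iff hT).2 hf), ← integral_indicator measurableSet_Ioo]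
  congr 1 with x
  by_cases hx : x ∈ Set.Ioo (0 : ℝ) 1
  · rw [Set.indicator_of_mem hx, ← integral_indicator measurableSet_Ioo]
    congr 1 with y
    simp only [Set.indicator_apply, Set.mem_ofPred_eq, Set.mem_Ioo, hx.1, true_and]
  · rw [Set.indicator_of_notMem hx]
    refine integral_eq_zero_of_ae (.of_forall fun y => Set.indicator_of_notMem ?_ f)
    rintro ⟨h0, h1, h2⟩
    exact hx ⟨h0, h1.trans h2⟩

/-- for `c > 1`, the integral of `(c-x₁)^{-3/2} (c-x₂)^{-3/2} (x₂-x₁)`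
over the triangle `0 < x₁ < x₂ < 1` equals `-4 log(c/(c-1)) + 4/√(c(c-1))`. -/
theorem integral_triangle_rpow_neg_three_halves (c : ℝ) (hc : 1 < c) :
    ∫ p in {p : ℝ × ℝ | 0 < p.1 ∧ p.1 < p.2 ∧ p.2 < 1},
        (c - p.1) ^ (-3/2 : ℝ) * (c - p.2) ^ (-3/2 : ℝ) * (p.2 - p.1)
          ∂(volume : Measure (ℝ × ℝ)) =
      -4 * Real.log (c / (c - 1)) + 4 / Real.sqrt (c * (c - 1)) := by
  rw [setIntegral_triangle_eq (integrableOn_triangle_rpow_neg_three_halves hc),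
    ← integral_outer_rpow_neg_three_halves hc, intervalIntegral.integral_of_le zero_le_one,
    integral_Ioc_eq_integral_Ioo]
  refine setIntegral_congr_fun measurableSet_Ioo fun x hx => ?_
  dsimp only
  rw [← integral_inner_rpow_neg_three_halves hc hx.2,
    intervalIntegral.integral_of_le hx.2.le, integral_Ioc_eq_integral_Ioo]
end

section
/- Let α ∈ (0,1) with α ≠ 1/2, and set β = 1 − α. Let ψ(x) denote the derivative at x of the function y ↦ log Γ(y), where Γ is the real Gamma function, and let γ denote the Euler–Mascheroni constant. Suppose C ∈ ℝ is such that the sequence N ↦ Σ_{m=1}^N ψ(mβ) − (N + 1/2 − 1/(2β))·log(Nβ) + N converges to C as N → ∞. Then ∫_0^1 (1 − u^{1−2α} − (1−2α)·u^{−α}·(1−u)) / ((1−u)·(1−u^{1−α})²) du = 1 − 2C + log(1−α)/(1−α) − α·γ/(1−α). -/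
open MeasureTheory Filter Topology

/-- The real digamma function, the derivative of `log ∘ Γ`. -/
noncomputable def realDigamma (x : ℝ) : ℝ :=
  deriv (fun y : ℝ => Real.log (Real.Gamma y)) x

lemma differentiableAt_log_Gamma {x : ℝ} (hx : 0 < x) :
    DifferentiableAt ℝ (fun y : ℝ => Real.log (Real.Gamma y)) x := by
  have hG : DifferentiableAt ℝ Real.Gamma x :=
    Real.differentiableAt_Gamma fun m => by
      have : (0 : ℝ) ≤ m := Nat.cast_nonneg m
      linarith
  exact hG.log (Real.Gamma_pos_of_pos hx).ne'

lemma log_Gamma_add_one {x : ℝ} (hx : 0 < x) :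
    Real.log (Real.Gamma (x + 1)) = Real.log x + Real.log (Real.Gamma x) := by
  rw [Real.Gamma_add_one hx.ne', Real.log_mul hx.ne' (Real.Gamma_pos_of_pos hx).ne']

lemma realDigamma_add_one {x : ℝ} (hx : 0 < x) :
    realDigamma (x + 1) = realDigamma x + 1 / x := by
  have h1 : deriv (fun y : ℝ => Real.log (Real.Gamma (y + 1))) x = realDigamma (x + 1) :=
    deriv_comp_add_const (f := fun y : ℝ => Real.log (Real.Gamma y)) 1 x
  rw [← h1]
  have h2 : (fun y : ℝ => Real.log (Real.Gamma (y + 1))) =ᶠ[𝓝 x]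
      fun y => Real.log y + Real.log (Real.Gamma y) := by
    filter_upwards [lt_mem_nhds hx] with y hy using log_Gamma_add_one hy
  rw [h2.deriv_eq]
  have h3 := (Real.hasDerivAt_log hx.ne').add (differentiableAt_log_Gamma hx).hasDerivAt
  have h4 := h3.deriv
  rw [show (fun y : ℝ => Real.log y + Real.log (Real.Gamma y)) =
    Real.log + fun y => Real.log (Real.Gamma y) from rfl, h4, realDigamma, one_div, add_comm]

lemma realDigamma_le_log {x : ℝ} (hx : 0 < x) : realDigamma x ≤ Real.log x := by
  have h := Real.convexOn_log_Gamma.deriv_le_slope (x := x) (y := x + 1) hx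
    (Set.mem_Ioi.2 (by linarith)) (by linarith) (differentiableAt_log_Gamma hx)
  have h2 := log_Gamma_add_one hx
  simp only [slope_def_field, Function.comp_apply, h2] at h
  have h3 : deriv (Real.log ∘ Real.Gamma) x = realDigamma x := rfl
  rw [h3] at h
  simpa using h

lemma log_sub_le_realDigamma {x : ℝ} (hx : 0 < x) :
    Real.log x - 1 / x ≤ realDigamma x := by
  have hx1 : 0 < x + 1 := by linarith
  have h := Real.convexOn_log_Gamma.slope_le_deriv (x := x) (y := x + 1) hx hx1
    (by linarith) (differentiableAt_log_Gamma hx1)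
  have h2 := log_Gamma_add_one hx
  simp only [slope_def_field, Function.comp_apply, h2] at h
  have h3 : deriv (Real.log ∘ Real.Gamma) (x + 1) = realDigamma (x + 1) := rfl
  rw [h3, realDigamma_add_one hx] at h
  have h4 : Real.log x ≤ realDigamma x + 1 / x := by simpa using h
  linarith

lemma realDigamma_one : realDigamma 1 = -Real.eulerMascheroniConstant := by
  have h := Real.hasDerivAt_Gamma_one.log (by simp)
  rw [realDigamma, h.deriv, Real.Gamma_one, div_one]

/-- The error of the approximation `ψ(x) ≈ log x - 1 / (2 x)`. -/
noncomputable def digammaError (x : ℝ) : ℝ := realDigamma x - Real.log x + 1 / (2 * x)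

lemma log_one_add_inv_eq {x : ℝ} (hx : 0 < x) :
    Real.log (1 + 1 / x) = Real.log (x + 1) - Real.log x := by
  rw [← Real.log_div (by linarith) hx.ne']
  congr 1
  field_simp

lemma digammaError_le_add_one {x : ℝ} (hx : 0 < x) :
    digammaError x ≤ digammaError (x + 1) := by
  have hx1 : 0 < x + 1 := by linarith
  have hy : 0 < 1 + 1 / x := by positivity
  have h := Real.self_le_sinh_iff.2 (Real.log_nonneg (x := 1 + 1 / x)
    (by have : 0 < 1 / x := by positivity
        linarith))
  rw [Real.sinh_log hy, log_one_add_inv_eq hx] at h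
  have e : (1 + 1 / x - (1 + 1 / x)⁻¹) / 2 = 1 / x - 1 / (2 * x) + 1 / (2 * (x + 1)) := by
    field_simp
    ring
  rw [e] at h
  unfold digammaError
  rw [realDigamma_add_one hx]
  linarith

lemma digammaError_add_one_add_le {x : ℝ} (hx : 0 < x) :
    digammaError (x + 1) + 1 / (8 * (x + 1) ^ 2) ≤ digammaError x + 1 / (8 * x ^ 2) := by
  have hx1 : 0 < x + 1 := by linarith
  have h := Real.le_log_one_add_of_nonneg (x := 1 / x) (by positivity)
  rw [log_one_add_inv_eq hx] at h
  have e : 2 * (1 / x) / (1 / x + 2) = 2 / (2 * x + 1) := by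
    field_simp
    ring
  rw [e] at h
  have key : 1 / x - 1 / (2 * x) + 1 / (2 * (x + 1)) - 2 / (2 * x + 1) ≤
      1 / (8 * x ^ 2) - 1 / (8 * (x + 1) ^ 2) := by
    have e2 : 1 / (8 * x ^ 2) - 1 / (8 * (x + 1) ^ 2) -
        (1 / x - 1 / (2 * x) + 1 / (2 * (x + 1)) - 2 / (2 * x + 1)) =
        ((2 * x + 1) ^ 2 - 4 * x * (x + 1)) / (8 * x ^ 2 * (x + 1) ^ 2 * (2 * x + 1)) := by
      field_simp
      ring
    have e3 : 0 ≤ ((2 * x + 1) ^ 2 - 4 * x * (x + 1)) /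
        (8 * x ^ 2 * (x + 1) ^ 2 * (2 * x + 1)) := by
      apply div_nonneg _ (by positivity)
      nlinarith
    linarith
  unfold digammaError
  rw [realDigamma_add_one hx]
  linarith

lemma abs_digammaError_le_inv {x : ℝ} (hx : 0 < x) : |digammaError x| ≤ 1 / (2 * x) := by
  have h1 := realDigamma_le_log hx
  have h2 := log_sub_le_realDigamma hx
  have e : 1 / x = 1 / (2 * x) + 1 / (2 * x) := by
    field_simp
    norm_num
  rw [abs_le]
  unfold digammaError
  constructor <;> linarith

lemma tendsto_digammaError_atTop : Tendsto digammaError atTop (𝓝 0) := by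
  have h : Tendsto (fun x : ℝ => 1 / (2 * x)) atTop (𝓝 0) :=
    tendsto_const_nhds.div_atTop (tendsto_id.const_mul_atTop two_pos)
  refine squeeze_zero_norm' ?_ h
  filter_upwards [eventually_gt_atTop 0] with x hx using abs_digammaError_le_inv hx

lemma tendsto_add_natCast_atTop (x : ℝ) : Tendsto (fun n : ℕ => x + (n : ℝ)) atTop atTop :=
  tendsto_atTop_add_const_left _ x tendsto_natCast_atTop_atTop

lemma abs_digammaError_le {x : ℝ} (hx : 0 < x) : |digammaError x| ≤ 1 / (8 * x ^ 2) := by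
  have hpos : ∀ n : ℕ, 0 < x + (n : ℝ) := fun n => by positivity
  have hlim := tendsto_digammaError_atTop.comp (tendsto_add_natCast_atTop x)
  have hmono : Monotone (fun n : ℕ => digammaError (x + n)) :=
    monotone_nat_of_le_succ fun n => by
      have := digammaError_le_add_one (hpos n)
      rwa [Nat.cast_succ, ← add_assoc]
  have hanti : Antitone (fun n : ℕ => digammaError (x + n) + 1 / (8 * (x + n) ^ 2)) :=
    antitone_nat_of_succ_le fun n => by
      have := digammaError_add_one_add_le (hpos n)
      rwa [Nat.cast_succ, ← add_assoc]
  have hsq : Tendsto (fun n : ℕ => 1 / (8 * (x + (n : ℝ)) ^ 2)) atTop (𝓝 0) :=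
    tendsto_const_nhds.div_atTop
      (((tendsto_pow_atTop two_ne_zero).comp (tendsto_add_natCast_atTop x)).const_mul_atTop
        (by norm_num))
  have h1 := hmono.ge_of_tendsto hlim 0
  have h2 := hanti.le_of_tendsto (by simpa using hlim.add hsq) 0
  simp only [Nat.cast_zero, add_zero] at h1 h2
  rw [abs_le]
  have : 0 ≤ 1 / (8 * x ^ 2) := by positivity
  constructor <;> linarith

lemma realDigamma_eq (x : ℝ) :
    realDigamma x = Real.log x - 1 / (2 * x) + digammaError x := by
  unfold digammaError
  ring

lemma tendsto_realDigamma_sub_log (a : ℝ) :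
    Tendsto (fun n : ℕ => realDigamma (a + n) - Real.log n) atTop (𝓝 0) := by
  have h1 := tendsto_digammaError_atTop.comp (tendsto_add_natCast_atTop a)
  have h2 : Tendsto (fun n : ℕ => Real.log ((n : ℝ) + a) - Real.log n) atTop (𝓝 0) :=
    (Real.tendsto_log_comp_add_sub_log a).comp tendsto_natCast_atTop_atTop
  have h3 : Tendsto (fun n : ℕ => 1 / (2 * (a + (n : ℝ)))) atTop (𝓝 0) :=
    tendsto_const_nhds.div_atTop ((tendsto_add_natCast_atTop a).const_mul_atTop two_pos)
  have h := (h1.add h2).sub h3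
  simp only [add_zero, sub_zero] at h
  refine h.congr fun n => ?_
  rw [realDigamma_eq (a + n), Function.comp_apply, add_comm (n : ℝ) a]
  ring

lemma sum_inv_sub_inv_eq {a b : ℝ} (ha : 0 < a) (hb : 0 < b) (N : ℕ) :
    ∑ n ∈ Finset.range N, (1 / (a + n) - 1 / (b + n)) =
      realDigamma (a + N) - realDigamma a - (realDigamma (b + N) - realDigamma b) := by
  induction N with
  | zero => simp
  | succ k ih =>
    have h1 := realDigamma_add_one (x := a + k) (by positivity)
    have h2 := realDigamma_add_one (x := b + k) (by positivity)
    rw [Finset.sum_range_succ, ih, Nat.cast_succ, ← add_assoc, ← add_assoc, h1, h2]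
    ring

lemma tendsto_sum_inv_sub_inv {a b : ℝ} (ha : 0 < a) (hb : 0 < b) :
    Tendsto (fun N : ℕ => ∑ n ∈ Finset.range N, (1 / (a + n) - 1 / (b + n))) atTop
      (𝓝 (realDigamma b - realDigamma a)) := by
  have h := ((tendsto_realDigamma_sub_log a).sub (tendsto_realDigamma_sub_log b)).add_const
    (realDigamma b - realDigamma a)
  simp only [sub_zero, zero_add] at h
  refine h.congr fun N => ?_
  rw [sum_inv_sub_inv_eq ha hb]
  ring

/-- Termwise integration of a series of nonnegative functions whose integrals have convergent
partial sums. -/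
lemma integrableOn_and_integral_eq_of_nonneg {F : ℕ → ℝ → ℝ} {f : ℝ → ℝ} {s : Set ℝ} {L : ℝ}
    (hs : MeasurableSet s) (hint : ∀ n, IntegrableOn (F n) s)
    (hnonneg : ∀ n, ∀ u ∈ s, 0 ≤ F n u) (hf : ∀ u ∈ s, HasSum (fun n => F n u) (f u))
    (hL : Tendsto (fun N => ∑ n ∈ Finset.range N, ∫ u in s, F n u) atTop (𝓝 L)) :
    IntegrableOn f s ∧ ∫ u in s, f u = L := by
  set G : ℕ → ℝ → ℝ := fun N u => ∑ n ∈ Finset.range N, F n u with hG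
  have hGint : ∀ N, Integrable (G N) (volume.restrict s) := fun N =>
    integrable_finsetSum _ fun n _ => hint n
  have hGL : Tendsto (fun N => ∫ u in s, G N u) atTop (𝓝 L) := by
    refine hL.congr fun N => ?_
    rw [hG, integral_finsetSum _ fun n _ => hint n]
  have hGf : ∀ᵐ u ∂(volume.restrict s), Tendsto (fun N => G N u) atTop (𝓝 (f u)) :=
    ae_restrict_of_forall_mem hs fun u hu => (hf u hu).tendsto_sum_nat
  have hGnonneg : ∀ N, 0 ≤ᵐ[volume.restrict s] G N := fun N =>
    ae_restrict_of_forall_mem hs fun u hu => Finset.sum_nonneg fun n _ => hnonneg n u hu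
  have hfin : Integrable f (volume.restrict s) := by
    refine integrable_of_tendsto hGf (fun N => (hGint N).1) ?_
    have h1 : ∀ N, ∫⁻ u in s, ‖G N u‖ₑ = ENNReal.ofReal (∫ u in s, G N u) := fun N => by
      rw [ofReal_integral_eq_lintegral_ofReal (hGint N) (hGnonneg N)]
      refine lintegral_congr_ae ?_
      filter_upwards [hGnonneg N] with u hu using Real.enorm_of_nonneg hu
    simp only [h1]
    have h2 : Tendsto (fun N => ENNReal.ofReal (∫ u in s, G N u)) atTop (𝓝 (ENNReal.ofReal L)) :=
      (ENNReal.continuous_ofReal.tendsto L).comp hGL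
    rw [h2.liminf_eq]
    exact ENNReal.ofReal_ne_top
  refine ⟨hfin, tendsto_nhds_unique ?_ hGL⟩
  refine integral_tendsto_of_tendsto_of_monotone hGint hfin ?_ hGf
  refine ae_restrict_of_forall_mem hs fun u hu => monotone_nat_of_le_succ fun N => ?_
  simp only [hG, Finset.sum_range_succ]
  linarith [hnonneg N u hu]

lemma integrableOn_and_integral_eq_of_nonpos {F : ℕ → ℝ → ℝ} {f : ℝ → ℝ} {s : Set ℝ} {L : ℝ}
    (hs : MeasurableSet s) (hint : ∀ n, IntegrableOn (F n) s)
    (hnonpos : ∀ n, ∀ u ∈ s, F n u ≤ 0) (hf : ∀ u ∈ s, HasSum (fun n => F n u) (f u))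
    (hL : Tendsto (fun N => ∑ n ∈ Finset.range N, ∫ u in s, F n u) atTop (𝓝 L)) :
    IntegrableOn f s ∧ ∫ u in s, f u = L := by
  obtain ⟨h1, h2⟩ := integrableOn_and_integral_eq_of_nonneg (F := fun n u => -F n u)
    (f := fun u => -f u) (L := -L) hs (fun n => (hint n).neg)
    (fun n u hu => neg_nonneg.2 (hnonpos n u hu)) (fun u hu => (hf u hu).neg)
    (by simpa only [integral_neg, Finset.sum_neg_distrib] using hL.neg)
  rw [integral_neg, neg_inj] at h2
  exact ⟨by simpa using h1.neg, h2⟩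

lemma integrableOn_rpow_sub_one {a : ℝ} (ha : 0 < a) :
    IntegrableOn (fun u : ℝ => u ^ (a - 1)) (Set.Ioo 0 1) :=
  (intervalIntegral.integrableOn_Ioo_rpow_iff one_pos).2 (by linarith)

lemma integral_rpow_sub_one {a : ℝ} (ha : 0 < a) :
    ∫ u in Set.Ioo (0 : ℝ) 1, u ^ (a - 1) = 1 / a := by
  rw [← integral_Ioc_eq_integral_Ioo, ← intervalIntegral.integral_of_le zero_le_one,
    integral_rpow (Or.inl (by linarith))]
  simp [ha.ne']

/-- Gauss' integral for differences of the digamma function, for ordered arguments. -/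
lemma integral_rpow_sub_rpow_div_of_le {a b : ℝ} (ha : 0 < a) (hab : a ≤ b) :
    IntegrableOn (fun u : ℝ => (u ^ (a - 1) - u ^ (b - 1)) / (1 - u)) (Set.Ioo 0 1) ∧
    ∫ u in Set.Ioo (0 : ℝ) 1, (u ^ (a - 1) - u ^ (b - 1)) / (1 - u) =
      realDigamma b - realDigamma a := by
  have hb : 0 < b := ha.trans_le hab
  have hpa : ∀ n : ℕ, 0 < a + n := fun n => by positivity
  have hpb : ∀ n : ℕ, 0 < b + n := fun n => by positivity
  refine integrableOn_and_integral_eq_of_nonneg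
    (F := fun n u => u ^ (a + n - 1) - u ^ (b + n - 1)) measurableSet_Ioo
    (fun n => (integrableOn_rpow_sub_one (hpa n)).sub (integrableOn_rpow_sub_one (hpb n)))
    (fun n u hu => ?_) (fun u hu => ?_) ?_
  · exact sub_nonneg.2 (Real.rpow_le_rpow_of_exponent_ge hu.1 hu.2.le (by linarith))
  · have h := (hasSum_geometric_of_lt_one hu.1.le hu.2).mul_left (u ^ (a - 1) - u ^ (b - 1))
    rw [← div_eq_mul_inv] at h
    refine h.congr_fun ?_
    intro n
    rw [show a + n - 1 = (a - 1) + n by ring, show b + n - 1 = (b - 1) + n by ring,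
      Real.rpow_add_natCast hu.1.ne', Real.rpow_add_natCast hu.1.ne']
    ring
  · refine (tendsto_sum_inv_sub_inv ha hb).congr fun N => Finset.sum_congr rfl fun n _ => ?_
    rw [integral_sub (integrableOn_rpow_sub_one (hpa n)) (integrableOn_rpow_sub_one (hpb n)),
      integral_rpow_sub_one (hpa n), integral_rpow_sub_one (hpb n)]

/-- Gauss' integral for differences of the digamma function. -/
lemma integral_rpow_sub_rpow_div {a b : ℝ} (ha : 0 < a) (hb : 0 < b) :
    IntegrableOn (fun u : ℝ => (u ^ (a - 1) - u ^ (b - 1)) / (1 - u)) (Set.Ioo 0 1) ∧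
    ∫ u in Set.Ioo (0 : ℝ) 1, (u ^ (a - 1) - u ^ (b - 1)) / (1 - u) =
      realDigamma b - realDigamma a := by
  rcases le_total a b with hab | hab
  · exact integral_rpow_sub_rpow_div_of_le ha hab
  · obtain ⟨h1, h2⟩ := integral_rpow_sub_rpow_div_of_le hb hab
    have e : (fun u : ℝ => (u ^ (a - 1) - u ^ (b - 1)) / (1 - u)) =
        fun u => -((u ^ (b - 1) - u ^ (a - 1)) / (1 - u)) := by
      funext u
      rw [← neg_div, neg_sub]
    rw [e, integral_neg, h2, neg_sub]
    exact ⟨h1.neg, rfl⟩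

lemma sinh_mul_le_mul_sinh {c s : ℝ} (hc0 : 0 ≤ c) (hc1 : c ≤ 1) (hs : 0 ≤ s) :
    Real.sinh (c * s) ≤ c * Real.sinh s := by
  have hd : ∀ x : ℝ, HasDerivAt (fun x => c * Real.sinh x - Real.sinh (c * x))
      (c * Real.cosh x - Real.cosh (c * x) * c) x := fun x => by
    have h := ((hasDerivAt_id x).const_mul c).sinh
    simp only [id, mul_one] at h
    exact ((Real.hasDerivAt_sinh x).const_mul c).sub h
  have hm : Monotone (fun x => c * Real.sinh x - Real.sinh (c * x)) := by
    refine monotone_of_deriv_nonneg (fun x => (hd x).differentiableAt) fun x => ?_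
    rw [(hd x).deriv]
    have : Real.cosh (c * x) ≤ Real.cosh x := by
      rw [Real.cosh_le_cosh, abs_mul, abs_of_nonneg hc0]
      exact mul_le_of_le_one_left (abs_nonneg x) hc1
    nlinarith
  have := hm hs
  simp only [mul_zero, Real.sinh_zero, sub_self] at this
  linarith

/-- The numerator `1 - u ^ c - c u ^ ((c - 1) / 2) (1 - u)` in terms of hyperbolic sines. -/
lemma one_sub_rpow_sub_eq {c u : ℝ} (hu : 0 < u) :
    1 - u ^ c - c * u ^ ((c - 1) / 2) * (1 - u) =
      2 * Real.exp (c * (Real.log u / 2)) *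
        (Real.sinh (c * (-Real.log u / 2)) - c * Real.sinh (-Real.log u / 2)) := by
  obtain ⟨s, rfl⟩ : ∃ s, u = Real.exp (2 * s) := ⟨Real.log u / 2, by
    rw [mul_div_cancel₀ _ two_ne_zero, Real.exp_log hu]⟩
  rw [← Real.exp_mul, ← Real.exp_mul, Real.log_exp, Real.sinh_eq, Real.sinh_eq]
  rw [show 2 * s / 2 = s by ring, show -(2 * s) / 2 = -s by ring,
    show c * -s = -(c * s) by ring, neg_neg, neg_neg,
    show 2 * s * c = c * s + c * s by ring, show 2 * s * ((c - 1) / 2) = c * s + -s by ring,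
    show 2 * s = s + s by ring, Real.exp_add, Real.exp_add, Real.exp_add, Real.exp_neg,
    Real.exp_neg]
  field_simp

lemma one_sub_rpow_sub_nonpos {c u : ℝ} (hc0 : 0 ≤ c) (hc1 : c ≤ 1) (hu0 : 0 < u) (hu1 : u ≤ 1) :
    1 - u ^ c - c * u ^ ((c - 1) / 2) * (1 - u) ≤ 0 := by
  rw [one_sub_rpow_sub_eq hu0]
  have h := sinh_mul_le_mul_sinh (s := -Real.log u / 2) hc0 hc1
    (by linarith [Real.log_nonpos hu0.le hu1])
  exact mul_nonpos_of_nonneg_of_nonpos (by positivity) (by linarith)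

lemma one_sub_rpow_sub_nonneg {c u : ℝ} (hc0 : c ≤ 0) (hc1 : -1 ≤ c) (hu0 : 0 < u)
    (hu1 : u ≤ 1) : 0 ≤ 1 - u ^ c - c * u ^ ((c - 1) / 2) * (1 - u) := by
  rw [one_sub_rpow_sub_eq hu0]
  have h := sinh_mul_le_mul_sinh (c := -c) (s := -Real.log u / 2) (by linarith) (by linarith)
    (by linarith [Real.log_nonpos hu0.le hu1])
  rw [neg_mul, Real.sinh_neg] at h
  exact mul_nonneg (by positivity) (by linarith)

lemma hasSum_succ_mul_geometric {q : ℝ} (hq0 : 0 ≤ q) (hq1 : q < 1) :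
    HasSum (fun n : ℕ => ((n : ℝ) + 1) * q ^ n) (1 / (1 - q) ^ 2) := by
  have hq : ‖q‖ < 1 := by rwa [Real.norm_of_nonneg hq0]
  have h := (hasSum_coe_mul_geometric_of_norm_lt_one hq).add (hasSum_geometric_of_lt_one hq0 hq1)
  have hne : 1 - q ≠ 0 := by linarith
  convert! h using 1
  · funext n
    ring
  · field_simp
    ring

lemma sum_succ_mul_realDigamma_sub {β : ℝ} (hβ : 0 < β) (M : ℕ) :
    ∑ m ∈ Finset.range (M + 1), ((m : ℝ) + 1) * (realDigamma ((m + 2) * β) -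
        realDigamma (m * β + 1) - (2 * β - 1) / ((m + 1) * β)) =
      -2 * ∑ m ∈ Finset.Icc 1 (M + 1), realDigamma (m * β) +
        (M + 2) * realDigamma ((M + 1) * β) + (M + 1) * realDigamma ((M + 2) * β) +
        Real.eulerMascheroniConstant - M / β - (harmonic M : ℝ) / β - (M + 1) * (2 - 1 / β) := by
  induction M with
  | zero =>
    simp [realDigamma_one]
    field_simp
  | succ k ih =>
    have h := realDigamma_add_one (x := ((k : ℝ) + 1) * β) (by positivity)
    rw [Finset.sum_range_succ, ih, Finset.sum_Icc_succ_top (by omega) (f := fun m : ℕ =>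
      realDigamma (m * β)) (b := k + 1), harmonic_succ]
    push_cast
    rw [h, show (k : ℝ) + 1 + 1 = k + 2 by ring]
    field_simp
    ring_nf

lemma tendsto_mul_digammaError {β : ℝ} (hβ : 0 < β) :
    Tendsto (fun n : ℕ => ((n : ℝ) + 1) * digammaError (n * β)) atTop (𝓝 0) := by
  have h : Tendsto (fun n : ℕ => (1 / (4 * β ^ 2)) * (1 / (n : ℝ))) atTop (𝓝 0) := by
    simpa only [mul_zero] using
      (tendsto_one_div_atTop_nhds_zero_nat (𝕜 := ℝ)).const_mul (1 / (4 * β ^ 2))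
  refine squeeze_zero_norm' ?_ h
  filter_upwards [eventually_ge_atTop 1] with n hn
  have hn1 : (1 : ℝ) ≤ n := by exact_mod_cast hn
  have hn0 : (0 : ℝ) < n := by linarith
  rw [norm_mul, Real.norm_of_nonneg (by positivity), Real.norm_eq_abs]
  calc ((n : ℝ) + 1) * |digammaError (n * β)|
      ≤ (n + n) * (1 / (8 * (n * β) ^ 2)) := by
        gcongr
        exact abs_digammaError_le (by positivity)
    _ = _ := by
        field_simp
        ring

lemma tendsto_mul_digammaError_succ {β : ℝ} (hβ : 0 < β) :
    Tendsto (fun n : ℕ => (n : ℝ) * digammaError ((n + 1) * β)) atTop (𝓝 0) := by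
  have h : Tendsto (fun n : ℕ => ((n + 1 : ℕ) + 1 : ℝ) * digammaError ((n + 1 : ℕ) * β)) atTop
      (𝓝 0) := (tendsto_add_atTop_iff_nat 1).2 (tendsto_mul_digammaError hβ)
  refine squeeze_zero_norm (fun n => ?_) (by simpa using h.norm)
  rw [norm_mul, Real.norm_eq_abs, Real.norm_eq_abs, abs_of_nonneg (Nat.cast_nonneg n), abs_of_nonneg
    (by positivity : (0 : ℝ) ≤ n + 1 + 1)]
  gcongr
  linarith

lemma tendsto_sum_succ_mul_realDigamma_sub {β C : ℝ} (hβ : 0 < β)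
    (hC : Tendsto (fun N : ℕ => (∑ m ∈ Finset.Icc 1 N, realDigamma (m * β)) -
        ((N : ℝ) + 1 / 2 - 1 / (2 * β)) * Real.log (N * β) + N) atTop (𝓝 C)) :
    Tendsto (fun N : ℕ => ∑ m ∈ Finset.range N, ((m : ℝ) + 1) * (realDigamma ((m + 2) * β) -
        realDigamma (m * β + 1) - (2 * β - 1) / ((m + 1) * β))) atTop
      (𝓝 (1 - 2 * C + Real.log β / β - (1 - β) * Real.eulerMascheroniConstant / β)) := by
  have hinv : Tendsto (fun n : ℕ => 1 / (n : ℝ)) atTop (𝓝 0) :=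
    tendsto_one_div_atTop_nhds_zero_nat
  have hlog : Tendsto (fun n : ℕ => (n : ℝ) * Real.log (1 + 1 / n)) atTop (𝓝 1) :=
    (Real.tendsto_mul_log_one_add_div_atTop 1).comp tendsto_natCast_atTop_atTop
  have hfrac : Tendsto (fun n : ℕ => (n : ℝ) / (n + 1)) atTop (𝓝 1) :=
    tendsto_natCast_div_add_atTop 1
  have hlim := ((((((hC.const_mul (-2)).add hlog).sub
    ((hinv.const_add 1).add hfrac |>.const_mul (1 / (2 * β)))).add
    (tendsto_mul_digammaError hβ)).add (tendsto_mul_digammaError_succ hβ)).sub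
    (Real.tendsto_harmonic_sub_log.div_const β)).add (hinv.div_const β) |>.add_const
    (Real.log β / β + Real.eulerMascheroniConstant + 1 / β)
  have e : -2 * C + 1 - 1 / (2 * β) * (1 + 0 + 1) + 0 + 0 - Real.eulerMascheroniConstant / β +
      0 / β + (Real.log β / β + Real.eulerMascheroniConstant + 1 / β) =
      1 - 2 * C + Real.log β / β - (1 - β) * Real.eulerMascheroniConstant / β := by
    field_simp
    ring
  rw [e] at hlim
  refine hlim.congr' ?_
  filter_upwards [eventually_ge_atTop 1] with n hn
  obtain ⟨M, rfl⟩ : ∃ M, n = M + 1 := ⟨n - 1, by omega⟩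
  have hM : (0 : ℝ) < M + 1 := by positivity
  have hM2 : (0 : ℝ) < M + 1 + 1 := by positivity
  rw [sum_succ_mul_realDigamma_sub hβ, harmonic_succ, log_one_add_inv_eq (by positivity)]
  push_cast
  rw [show (M : ℝ) + 2 = M + 1 + 1 by ring, realDigamma_eq ((M + 1) * β),
    realDigamma_eq ((M + 1 + 1) * β), Real.log_mul hM.ne' hβ.ne', Real.log_mul hM2.ne' hβ.ne']
  field_simp
  ring_nf

/-- for `α ∈ (0,1)`, `α ≠ 1/2`, with `β = 1 - α`, if `C` is the Barnes
modular constant, i.e. `Σ_{m=1}^N ψ(mβ) - (N + 1/2 - 1/(2β)) log(Nβ) + N → C`, where `ψ`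
is the digamma function (the derivative of `log ∘ Γ`), then
`∫_0^1 (1 - u^{1-2α} - (1-2α) u^{-α} (1-u)) / ((1-u)(1-u^{1-α})²) du
  = 1 - 2C + log(1-α)/(1-α) - αγ/(1-α)`,
with `γ` the Euler–Mascheroni constant. -/
theorem integral_eq_barnes_constant (α : ℝ) (hα0 : 0 < α) (hα1 : α < 1)
    (hα2 : α ≠ 1 / 2) (C : ℝ)
    (hC : Tendsto (fun N : ℕ =>
        (∑ m ∈ Finset.Icc 1 N,
            deriv (fun y : ℝ => Real.log (Real.Gamma y)) ((m : ℝ) * (1 - α))) -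
          ((N : ℝ) + 1 / 2 - 1 / (2 * (1 - α))) * Real.log ((N : ℝ) * (1 - α)) + N)
      atTop (𝓝 C)) :
    ∫ u in Set.Ioo (0 : ℝ) 1,
        (1 - u ^ (1 - 2 * α) - (1 - 2 * α) * u ^ (-α) * (1 - u)) /
          ((1 - u) * (1 - u ^ (1 - α)) ^ 2) =
      1 - 2 * C + Real.log (1 - α) / (1 - α) -
        α * Real.eulerMascheroniConstant / (1 - α) := by
  have hβ : 0 < 1 - α := by linarith
  set β := 1 - α with hβdef
  have hα : α = 1 - β := by linarith
  have hL := tendsto_sum_succ_mul_realDigamma_sub hβ hC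
  rw [← hα] at hL
  set F : ℕ → ℝ → ℝ := fun m u => ((m : ℝ) + 1) * ((u ^ β) ^ m *
    ((1 - u ^ (1 - 2 * α) - (1 - 2 * α) * u ^ (-α) * (1 - u)) / (1 - u))) with hF
  have hFeq : ∀ m : ℕ, ∀ u ∈ Set.Ioo (0 : ℝ) 1, F m u = ((m : ℝ) + 1) *
      ((u ^ (m * β + 1 - 1) - u ^ ((m + 2) * β - 1)) / (1 - u) -
        (2 * β - 1) * u ^ ((m + 1) * β - 1)) := by
    intro m u hu
    have h1u : 1 - u ≠ 0 := by linarith [hu.2]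
    have e1 : u ^ (m * β + 1 - 1) = (u ^ β) ^ m := by
      rw [← Real.rpow_mul_natCast hu.1.le]
      ring_nf
    have e2 : u ^ ((m + 2) * β - 1) = (u ^ β) ^ m * u ^ (1 - 2 * α) := by
      rw [← Real.rpow_mul_natCast hu.1.le, ← Real.rpow_add hu.1, hα]
      ring_nf
    have e3 : u ^ ((m + 1) * β - 1) = (u ^ β) ^ m * u ^ (-α) := by
      rw [← Real.rpow_mul_natCast hu.1.le, ← Real.rpow_add hu.1, hα]
      ring_nf
    rw [e1, e2, e3, hF, show 2 * β - 1 = 1 - 2 * α by rw [hβdef]; ring]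
    field_simp
  have hg : ∀ m : ℕ, IntegrableOn (fun u : ℝ => (u ^ (m * β + 1 - 1) -
      u ^ ((m + 2) * β - 1)) / (1 - u)) (Set.Ioo 0 1) ∧ _ := fun m =>
    integral_rpow_sub_rpow_div (a := m * β + 1) (b := (m + 2) * β) (by positivity) (by positivity)
  have hp : ∀ m : ℕ, 0 < ((m : ℝ) + 1) * β := fun m => by positivity
  have hint : ∀ m, IntegrableOn (F m) (Set.Ioo 0 1) := fun m =>
    IntegrableOn.congr_fun (((hg m).1.sub
      ((integrableOn_rpow_sub_one (hp m)).const_mul (2 * β - 1))).const_mul ((m : ℝ) + 1))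
      (fun u hu => (hFeq m u hu).symm) measurableSet_Ioo
  have hval : ∀ m : ℕ, ∫ u in Set.Ioo (0 : ℝ) 1, F m u = ((m : ℝ) + 1) *
      (realDigamma ((m + 2) * β) - realDigamma (m * β + 1) - (2 * β - 1) / ((m + 1) * β)) := by
    intro m
    rw [setIntegral_congr_fun measurableSet_Ioo (hFeq m), integral_const_mul,
      integral_sub (hg m).1 ((integrableOn_rpow_sub_one (hp m)).const_mul _), (hg m).2,
      integral_const_mul, integral_rpow_sub_one (hp m), mul_one_div]
  simp only [← hval] at hL
  have hsum : ∀ u ∈ Set.Ioo (0 : ℝ) 1, HasSum (fun m => F m u)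
      ((1 - u ^ (1 - 2 * α) - (1 - 2 * α) * u ^ (-α) * (1 - u)) /
        ((1 - u) * (1 - u ^ β) ^ 2)) := by
    intro u hu
    have h := (hasSum_succ_mul_geometric (Real.rpow_nonneg hu.1.le β)
      (Real.rpow_lt_one hu.1.le hu.2 hβ)).mul_right
      ((1 - u ^ (1 - 2 * α) - (1 - 2 * α) * u ^ (-α) * (1 - u)) / (1 - u))
    rw [div_mul_div_comm, one_mul, mul_comm (_ ^ 2)] at h
    simpa only [hF, mul_assoc] using h
  have hexp : -α = ((1 - 2 * α) - 1) / 2 := by ring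
  rcases le_total 0 (1 - 2 * α) with hc | hc
  · refine (integrableOn_and_integral_eq_of_nonpos measurableSet_Ioo hint (fun m u hu => ?_)
      hsum hL).2
    have hN := one_sub_rpow_sub_nonpos hc (by linarith) hu.1 hu.2.le
    rw [← hexp] at hN
    have hq := Real.rpow_nonneg hu.1.le β
    exact mul_nonpos_of_nonneg_of_nonpos (by positivity) (mul_nonpos_of_nonneg_of_nonpos
      (by positivity) (div_nonpos_of_nonpos_of_nonneg hN (by linarith [hu.2])))
  · refine (integrableOn_and_integral_eq_of_nonneg measurableSet_Ioo hint (fun m u hu => ?_)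
      hsum hL).2
    have hN := one_sub_rpow_sub_nonneg hc (by linarith) hu.1 hu.2.le
    rw [← hexp] at hN
    have hq := Real.rpow_nonneg hu.1.le β
    exact mul_nonneg (by positivity) (mul_nonneg (by positivity)
      (div_nonneg hN (by linarith [hu.2])))
end

section
/- The integral ∫_0^1 (u^{−1/2}·(1−u) + log u) / ((1−u)·(1−u^{1/2})²) du equals π²/8 − 1/2. -/
open MeasureTheory

open Filter Topology in
/-- The fundamental theorem of calculus on an open interval for a nonnegative derivative. -/
theorem integrableOn_and_integral_Ioo_of_hasDerivAt_of_nonneg {f f' : ℝ → ℝ} {a b fa fb : ℝ}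
    (hab : a < b) (hderiv : ∀ x ∈ Set.Ioo a b, HasDerivAt f (f' x) x)
    (hpos : ∀ x ∈ Set.Ioo a b, 0 ≤ f' x)
    (ha : Tendsto f (𝓝[>] a) (𝓝 fa)) (hb : Tendsto f (𝓝[<] b) (𝓝 fb)) :
    IntegrableOn f' (Set.Ioo a b) ∧ ∫ x in Set.Ioo a b, f' x = fb - fa := by
  have hcont : ContinuousOn f (Set.Ioo a b) := fun x hx =>
    (hderiv x hx).continuousAt.continuousWithinAt
  have hint : IntegrableOn f' (Set.Ioc a b) := by
    refine intervalIntegral.integrableOn_deriv_of_nonneg (g := extendFrom (Set.Ioo a b) f)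
      (continuousOn_Icc_extendFrom_Ioo hcont ha hb) (fun x hx => ?_) hpos
    refine (hderiv x hx).congr_of_eventuallyEq ?_
    filter_upwards [Ioo_mem_nhds hx.1 hx.2] with y hy
    exact extendFrom_eq (subset_closure hy) (hcont y hy)
  refine ⟨hint.mono_set Set.Ioo_subset_Ioc_self, ?_⟩
  rw [← integral_Ioc_eq_integral_Ioo, ← intervalIntegral.integral_of_le hab.le]
  exact intervalIntegral.integral_eq_sub_of_hasDerivAt_of_tendsto hab hderiv
    ((intervalIntegrable_iff_integrableOn_Ioc_of_le hab.le).2 hint) ha hb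

open Filter Topology in
theorem integrableOn_and_integral_neg_log_mul_rpow {s : ℝ} (hs : 0 < s) :
    IntegrableOn (fun u : ℝ => -Real.log u * u ^ (s - 1)) (Set.Ioo 0 1) ∧
      ∫ u in Set.Ioo (0 : ℝ) 1, -Real.log u * u ^ (s - 1) = 1 / s ^ 2 := by
  have h := integrableOn_and_integral_Ioo_of_hasDerivAt_of_nonneg
    (f := fun u : ℝ => u ^ s / s ^ 2 - Real.log u * u ^ s / s)
    (f' := fun u : ℝ => -Real.log u * u ^ (s - 1)) (fa := 0) (fb := 1 / s ^ 2)
    zero_lt_one ?_ ?_ ?_ ?_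
  · simpa using h
  · intro x hx
    have hr := Real.hasDerivAt_rpow_const (x := x) (p := s) (Or.inl hx.1.ne')
    have hl := Real.hasDerivAt_log hx.1.ne'
    convert! (hr.div_const (s ^ 2)).sub ((hl.mul hr).div_const s) using 1
    have : x ^ s = x ^ (s - 1) * x := by
      rw [← Real.rpow_add_one hx.1.ne']; simp
    have := hx.1.ne'
    simp only [‹x ^ s = _›]
    field_simp
    ring
  · intro x hx
    exact mul_nonneg (neg_nonneg.2 (Real.log_nonpos hx.1.le hx.2.le)) (Real.rpow_nonneg hx.1.le _)
  · have h1 := (tendsto_log_mul_rpow_nhdsGT_zero hs).div_const s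
    have h2 : Tendsto (fun u : ℝ => u ^ s / s ^ 2) (𝓝[>] 0) (𝓝 0) := by
      have : Tendsto (fun u : ℝ => u ^ s / s ^ 2) (𝓝 0) (𝓝 (0 ^ s / s ^ 2)) :=
        ((Real.continuousAt_rpow_const 0 s (Or.inr hs.le)).tendsto).div_const _
      rw [Real.zero_rpow hs.ne', zero_div] at this
      exact this.mono_left nhdsWithin_le_nhds
    simpa using h2.sub h1
  · have hr := (Real.continuousAt_rpow_const 1 s (Or.inl one_ne_zero)).tendsto
    have hl := (Real.continuousAt_log (one_ne_zero (α := ℝ))).tendsto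
    have := (hr.div_const (s ^ 2)).sub ((hl.mul hr).div_const s)
    simp only [Real.one_rpow, Real.log_one, zero_mul, zero_div, sub_zero] at this
    exact this.mono_left nhdsWithin_le_nhds

theorem hasSum_one_div_odd_sq :
    HasSum (fun n : ℕ => 1 / (2 * (n : ℝ) + 1) ^ 2) (Real.pi ^ 2 / 8) := by
  have hz := hasSum_zeta_two
  have he : HasSum (fun n : ℕ => (1 : ℝ) / ((2 * n : ℕ) : ℝ) ^ 2) (Real.pi ^ 2 / 24) := by
    convert! hz.div_const 4 using 1
    · ext n
      push_cast
      rw [mul_pow, div_div, mul_comm]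
      norm_num
    · ring
  have hodd : Summable (fun n : ℕ => (1 : ℝ) / ((2 * n + 1 : ℕ) : ℝ) ^ 2) :=
    hz.summable.comp_injective (i := fun n : ℕ => 2 * n + 1) (fun a b h => by simpa using h)
  have h := (HasSum.even_add_odd (f := fun n : ℕ => (1 : ℝ) / (n : ℝ) ^ 2) he hodd.hasSum).unique hz
  have hsum := hodd.hasSum
  rw [show ∑' n : ℕ, (1 : ℝ) / ((2 * n + 1 : ℕ) : ℝ) ^ 2 = Real.pi ^ 2 / 8 by linarith] at hsum
  exact_mod_cast hsum

theorem integral_neg_log_div_sqrt_mul_one_sub :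
    ∫ u in Set.Ioo (0 : ℝ) 1, -Real.log u / (4 * √u * (1 - u)) = Real.pi ^ 2 / 8 := by
  let F : ℕ → ℝ → ℝ := fun n u => (1 / 4) * (-Real.log u * u ^ (((n : ℝ) + 1 / 2) - 1))
  have hF (n : ℕ) := integrableOn_and_integral_neg_log_mul_rpow (s := (n : ℝ) + 1 / 2) (by positivity)
  have hval n : ∫ u in Set.Ioo (0 : ℝ) 1, F n u = 1 / (2 * (n : ℝ) + 1) ^ 2 := by
    rw [integral_const_mul, (hF n).2]
    field_simp
    norm_num
  have hnorm n : ∫ u in Set.Ioo (0 : ℝ) 1, ‖F n u‖ = 1 / (2 * (n : ℝ) + 1) ^ 2 := by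
    rw [← hval n]
    refine setIntegral_congr_fun measurableSet_Ioo fun u hu => Real.norm_of_nonneg ?_
    exact mul_nonneg (by norm_num) (mul_nonneg
      (neg_nonneg.2 (Real.log_nonpos hu.1.le hu.2.le)) (Real.rpow_nonneg hu.1.le _))
  have h := hasSum_integral_of_summable_integral_norm (F := F)
    (μ := volume.restrict (Set.Ioo 0 1)) (fun n => (hF n).1.const_mul _)
    (by simpa only [hnorm] using hasSum_one_div_odd_sq.summable)
  simp only [hval] at h
  rw [← h.unique hasSum_one_div_odd_sq]
  refine setIntegral_congr_fun measurableSet_Ioo fun u hu => ?_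
  have hpow (n : ℕ) : F n u = (-Real.log u / (4 * √u)) * u ^ n := by
    have hu0 := Real.sqrt_pos.2 hu.1
    have : u ^ (((n : ℝ) + 1 / 2) - 1) = u ^ n / √u := by
      rw [show ((n : ℝ) + 1 / 2) - 1 = n - 1 / 2 by ring, Real.rpow_sub hu.1, Real.rpow_natCast,
        Real.sqrt_eq_rpow]
    simp only [F, this]
    field_simp
  simp only [hpow, tsum_mul_left, tsum_geometric_of_lt_one hu.1.le hu.2]
  rw [← div_eq_mul_inv, div_div]

theorem log_le_two_mul_sub_one_div {t : ℝ} (ht : 0 < t) (ht1 : t < 1) :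
    Real.log t ≤ 2 * (t - 1) / (t + 1) := by
  have h := Real.le_log_one_add_of_nonneg (x := t⁻¹ - 1) (by linarith [(one_lt_inv₀ ht).2 ht1])
  rw [add_sub_cancel, Real.log_inv] at h
  have : 2 * (t⁻¹ - 1) / (t⁻¹ - 1 + 2) = -(2 * (t - 1) / (t + 1)) := by
    have : t⁻¹ - 1 + 2 = (t + 1) / t := by field_simp; ring
    rw [this]
    field_simp
    ring
  linarith

theorem sub_inv_div_two_le_log {t : ℝ} (ht : 0 < t) (ht1 : t < 1) :
    (t - t⁻¹) / 2 ≤ Real.log t := by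
  rw [← Real.sinh_log ht]
  exact Real.sinh_le_self_iff.2 (Real.log_nonpos ht.le ht1.le)

open Filter Topology in
theorem integrableOn_and_integral_elementary_part :
    IntegrableOn (fun u : ℝ => -(2 * (1 - √u) + Real.log √u * (1 + √u)) /
        (2 * √u * (1 - √u) ^ 3)) (Set.Ioo 0 1) ∧
      ∫ u in Set.Ioo (0 : ℝ) 1, -(2 * (1 - √u) + Real.log √u * (1 + √u)) /
        (2 * √u * (1 - √u) ^ 3) = 1 / 2 := by
  let H : ℝ → ℝ := fun t => -(Real.log t * t / (1 - t) ^ 2 + 1 / (1 - t))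
  have hmem {x : ℝ} (hx : x ∈ Set.Ioo (0 : ℝ) 1) : √x ∈ Set.Ioo (0 : ℝ) 1 :=
    ⟨Real.sqrt_pos.2 hx.1, by rw [Real.sqrt_lt' one_pos]; simpa using hx.2⟩
  have hH0 : Tendsto H (𝓝[>] 0) (𝓝 (-1)) := by
    have h1 := tendsto_log_mul_rpow_nhdsGT_zero one_pos
    simp only [Real.rpow_one] at h1
    have hs : Tendsto (fun t : ℝ => 1 - t) (𝓝[>] 0) (𝓝 1) := by
      have : Tendsto (fun t : ℝ => 1 - t) (𝓝 0) (𝓝 (1 - 0)) :=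
        tendsto_const_nhds.sub tendsto_id
      rw [sub_zero] at this
      exact this.mono_left nhdsWithin_le_nhds
    have := ((h1.div (hs.pow 2) (by norm_num)).add
      ((tendsto_const_nhds (x := (1 : ℝ))).div hs one_ne_zero)).neg
    simpa [H] using this
  have hH1 : Tendsto H (𝓝[<] 1) (𝓝 (-(1 / 2))) := by
    have hlow : Tendsto (fun t : ℝ => -(1 / (1 + t))) (𝓝[<] 1) (𝓝 (-(1 / 2))) := by
      have : ContinuousAt (fun t : ℝ => -(1 / (1 + t))) 1 := by
        fun_prop (disch := norm_num)
      have h2 := this.tendsto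
      norm_num at h2 ⊢
      exact h2.mono_left nhdsWithin_le_nhds
    refine tendsto_of_tendsto_of_tendsto_of_le_of_le' hlow tendsto_const_nhds ?_ ?_
    · filter_upwards [Ioo_mem_nhdsLT (zero_lt_one (α := ℝ))] with t ht
      have hs : 0 < 1 - t := by linarith [ht.2]
      have hp : 0 < 1 + t := by linarith [ht.1]
      have hl := log_le_two_mul_sub_one_div ht.1 ht.2
      rw [add_comm t 1, le_div_iff₀ hp] at hl
      simp only [H, neg_le_neg_iff]
      rw [div_add_div _ _ (by positivity) hs.ne', div_le_div_iff₀ (by positivity) hp]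
      have := mul_le_mul_of_nonneg_left hl (mul_nonneg ht.1.le hs.le)
      nlinarith
    · filter_upwards [Ioo_mem_nhdsLT (zero_lt_one (α := ℝ))] with t ht
      have hs : 0 < 1 - t := by linarith [ht.2]
      have hl := mul_le_mul_of_nonneg_left (sub_inv_div_two_le_log ht.1 ht.2) ht.1.le
      have : t * ((t - t⁻¹) / 2) = (t ^ 2 - 1) / 2 := by
        have := ht.1.ne'
        field_simp
      rw [this] at hl
      simp only [H, neg_le_neg_iff]
      rw [div_add_div _ _ (by positivity) hs.ne', div_le_div_iff₀ (by positivity) (by positivity)]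
      have := mul_le_mul_of_nonneg_left hl hs.le
      nlinarith
  have h := integrableOn_and_integral_Ioo_of_hasDerivAt_of_nonneg
    (f := fun u : ℝ => H √u)
    (f' := fun u : ℝ => -(2 * (1 - √u) + Real.log √u * (1 + √u)) / (2 * √u * (1 - √u) ^ 3))
    (fa := -1) (fb := -(1 / 2)) zero_lt_one ?_ ?_ ?_ ?_
  · exact ⟨h.1, h.2.trans (by norm_num)⟩
  · intro x hx
    obtain ⟨ht0, ht1⟩ := hmem hx
    have hsq := (hasDerivAt_id x).sqrt hx.1.ne'
    have hd : HasDerivAt H (-(2 * (1 - √x) + Real.log √x * (1 + √x)) / (1 - √x) ^ 3) √x := by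
      have hne : 1 - √x ≠ 0 := by linarith
      have hs := (hasDerivAt_id √x).const_sub 1
      have hl := (Real.hasDerivAt_log ht0.ne').mul (hasDerivAt_id √x)
      have hi := (hasDerivAt_const √x (1 : ℝ)).div hs hne
      convert! ((hl.div (hs.pow 2) (pow_ne_zero 2 hne)).add hi).neg using 1
      simp only [id, Pi.mul_apply, Pi.pow_apply]
      have := ht0.ne'
      field_simp
      ring
    convert! hd.comp x hsq using 1
    simp only [id]
    rw [div_mul_div_comm]
    ring
  · intro x hx
    obtain ⟨ht0, ht1⟩ := hmem hx
    have hl := log_le_two_mul_sub_one_div ht0 ht1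
    rw [le_div_iff₀ (by linarith)] at hl
    have : 0 < 1 - √x := by linarith
    exact div_nonneg (by linarith) (by positivity)
  · refine hH0.comp (tendsto_nhdsWithin_iff.2 ⟨?_, ?_⟩)
    · have := Real.continuous_sqrt.tendsto 0
      rw [Real.sqrt_zero] at this
      exact this.mono_left nhdsWithin_le_nhds
    · filter_upwards [self_mem_nhdsWithin] with x hx using Real.sqrt_pos.2 hx
  · refine hH1.comp (tendsto_nhdsWithin_iff.2 ⟨?_, ?_⟩)
    · have := Real.continuous_sqrt.tendsto 1
      rw [Real.sqrt_one] at this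
      exact this.mono_left nhdsWithin_le_nhds
    · filter_upwards [Ioo_mem_nhdsLT (zero_lt_one (α := ℝ))] with x hx using (hmem hx).2

/-- `∫_0^1 (u^{-1/2}(1-u) + log u) / ((1-u)(1-u^{1/2})²) du = π²/8 - 1/2`. -/
theorem integral_half_case :
    ∫ u in Set.Ioo (0 : ℝ) 1,
        (u ^ (-(1 : ℝ) / 2) * (1 - u) + Real.log u) /
          ((1 - u) * (1 - u ^ ((1 : ℝ) / 2)) ^ 2) =
      Real.pi ^ 2 / 8 - 1 / 2 := by
  obtain ⟨hint, hval⟩ := integrableOn_and_integral_elementary_part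
  have hlog : IntegrableOn (fun u : ℝ => -Real.log u / (4 * √u * (1 - u))) (Set.Ioo 0 1) := by
    by_contra h
    have h0 := integral_undef h
    rw [integral_neg_log_div_sqrt_mul_one_sub] at h0
    exact (by positivity : Real.pi ^ 2 / 8 ≠ 0) h0
  refine Eq.trans ?_ ((integral_sub hlog hint).trans
    (congrArg₂ _ integral_neg_log_div_sqrt_mul_one_sub hval))
  refine setIntegral_congr_fun measurableSet_Ioo fun u hu => ?_
  have hneg : u ^ (-(1 : ℝ) / 2) = (√u)⁻¹ := by
    rw [neg_div, Real.rpow_neg hu.1.le, Real.sqrt_eq_rpow]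
  have hlogu : Real.log √u = Real.log u / 2 := Real.log_sqrt hu.1.le
  have ht0 : 0 < √u := Real.sqrt_pos.2 hu.1
  have ht1 : √u < 1 := by rw [Real.sqrt_lt' one_pos]; simpa using hu.2
  have hsq : 1 - u = (1 - √u) * (1 + √u) := by
    linear_combination Real.sq_sqrt hu.1.le
  simp only [hneg, ← Real.sqrt_eq_rpow, hlogu]
  rw [hsq]
  have h1 : 1 - √u ≠ 0 := by linarith
  have h2 : 1 + √u ≠ 0 := by linarith
  field_simp
  ring
end
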